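/- arXiv:2006.02611 — 2 statements merged into one kernel-verified Lean document; each statement's English description precedes it below -/
import Mathlib

section
/- Let B₁, …, B_T be real d₁ × d₂ matrices, let M be a real d₂ × d₂ matrix with ‖M‖_S ≤ 1, let h be an integer with 1 ≤ h < T, and let E_t and E'_t (t = h+1, …, T) be real d₁ × d₂ matrices. Then | ‖Σ_{t=h+1}^T B_{t−h} M E_tᵀ‖_S − ‖Σ_{t=h+1}^T B_{t−h} M (E'_t)ᵀ‖_S | ≤ ‖Σ_{t=1}^T B_t B_tᵀ‖_S^{1/2} · (Σ_{t=h+1}^T ‖E_t − E'_t‖_F²)^{1/2}. -/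
open Matrix Finset

/-- Spectral norm (largest singular value) of a real matrix, as the operator norm of the
associated linear map between Euclidean spaces. -/
noncomputable def specNorm {m n : Type*} [Fintype m] [Fintype n] [DecidableEq n]
    (A : Matrix m n ℝ) : ℝ :=
  ‖LinearMap.toContinuousLinearMap (Matrix.toEuclideanLin A)‖

/-- Frobenius norm of a real matrix. -/
noncomputable def frobNorm {m n : Type*} [Fintype m] [Fintype n] (A : Matrix m n ℝ) : ℝ :=
  Real.sqrt (∑ i, ∑ j, (A i j) ^ 2)

theorem norm_toEuclideanLin_le_specNorm {m n : Type*} [Fintype m] [Fintype n] [DecidableEq n]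
    (A : Matrix m n ℝ) (x : EuclideanSpace ℝ n) :
    ‖toEuclideanLin A x‖ ≤ specNorm A * ‖x‖ :=
  (LinearMap.toContinuousLinearMap (toEuclideanLin A)).le_opNorm x

theorem abs_specNorm_sub_specNorm_le {m n : Type*} [Fintype m] [Fintype n] [DecidableEq n]
    (A B : Matrix m n ℝ) : |specNorm A - specNorm B| ≤ specNorm (A - B) := by
  unfold specNorm
  rw [map_sub, map_sub]
  exact abs_norm_sub_norm_le _ _

theorem toEuclideanLin_mul_apply {l m n : Type*} [Fintype m] [Fintype n]
    [DecidableEq m] [DecidableEq n]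
    (A : Matrix l m ℝ) (B : Matrix m n ℝ) (x : EuclideanSpace ℝ n) :
    toEuclideanLin (A * B) x = toEuclideanLin A (toEuclideanLin B x) := by
  simp [toLpLin_apply, mulVec_mulVec]

theorem inner_toEuclideanLin_right {m n : Type*} [Fintype m] [Fintype n]
    [DecidableEq m] [DecidableEq n]
    (A : Matrix m n ℝ) (x : EuclideanSpace ℝ m) (y : EuclideanSpace ℝ n) :
    inner ℝ x (toEuclideanLin A y) = inner ℝ (toEuclideanLin Aᵀ x) y := by
  rw [← conjTranspose_eq_transpose_of_trivial, toEuclideanLin_conjTranspose_eq_adjoint,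
    LinearMap.adjoint_inner_left]

theorem norm_toEuclideanLin_transpose_le_frobNorm {m n : Type*} [Fintype m] [Fintype n]
    [DecidableEq m] (A : Matrix m n ℝ) (x : EuclideanSpace ℝ m) :
    ‖toEuclideanLin Aᵀ x‖ ≤ frobNorm A * ‖x‖ := by
  rw [EuclideanSpace.norm_eq, EuclideanSpace.norm_eq, frobNorm,
    ← Real.sqrt_mul (by positivity), Finset.sum_comm, Finset.sum_mul]
  gcongr with j
  simp only [Real.norm_eq_abs, sq_abs, toLpLin_apply, mulVec, dotProduct, transpose_apply]
  exact Finset.sum_mul_sq_le_sq_mul_sq _ _ _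

/-- The Gram matrix `∑ B_t B_tᵀ` controls the total energy of the vectors `B_tᵀ x`. -/
theorem sum_norm_sq_toEuclideanLin_transpose_le {ι m n : Type*} [Fintype m] [Fintype n]
    [DecidableEq m] [DecidableEq n] (s : Finset ι) (B : ι → Matrix m n ℝ)
    (x : EuclideanSpace ℝ m) :
    ∑ t ∈ s, ‖toEuclideanLin (B t)ᵀ x‖ ^ 2 ≤
      specNorm (∑ t ∈ s, B t * (B t)ᵀ) * ‖x‖ ^ 2 := by
  calc ∑ t ∈ s, ‖toEuclideanLin (B t)ᵀ x‖ ^ 2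
      = inner ℝ x (toEuclideanLin (∑ t ∈ s, B t * (B t)ᵀ) x) := by
        rw [map_sum, LinearMap.sum_apply, inner_sum]
        refine Finset.sum_congr rfl fun t _ => ?_
        rw [toEuclideanLin_mul_apply, inner_toEuclideanLin_right, real_inner_self_eq_norm_sq]
    _ ≤ ‖x‖ * ‖toEuclideanLin (∑ t ∈ s, B t * (B t)ᵀ) x‖ := real_inner_le_norm _ _
    _ ≤ ‖x‖ * (specNorm (∑ t ∈ s, B t * (B t)ᵀ) * ‖x‖) := by
        gcongr
        exact norm_toEuclideanLin_le_specNorm _ _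
    _ = _ := by ring

/-- Cauchy–Schwarz bound for the spectral norm of `∑ B_t M D_tᵀ`. -/
theorem specNorm_sum_mul_mul_transpose_le {ι m n k : Type*} [Fintype m] [Fintype n] [Fintype k]
    [DecidableEq m] [DecidableEq n] [DecidableEq k] (s : Finset ι) (B : ι → Matrix m n ℝ)
    (M : Matrix n n ℝ) (hM : specNorm M ≤ 1) (D : ι → Matrix k n ℝ) {K : ℝ}
    (hK : ∀ x : EuclideanSpace ℝ m, ∑ t ∈ s, ‖toEuclideanLin (B t)ᵀ x‖ ^ 2 ≤ K * ‖x‖ ^ 2) :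
    specNorm (∑ t ∈ s, B t * M * (D t)ᵀ) ≤
      Real.sqrt K * Real.sqrt (∑ t ∈ s, frobNorm (D t) ^ 2) := by
  refine ContinuousLinearMap.opNorm_le_bound _ (by positivity) fun y => ?_
  change ‖toEuclideanLin (∑ t ∈ s, B t * M * (D t)ᵀ) y‖ ≤ _
  set x := toEuclideanLin (∑ t ∈ s, B t * M * (D t)ᵀ) y with hx
  have hterm : ∀ t, ‖toEuclideanLin M (toEuclideanLin (D t)ᵀ y)‖ ≤ frobNorm (D t) * ‖y‖ :=
    fun t => calc
      _ ≤ specNorm M * ‖toEuclideanLin (D t)ᵀ y‖ := norm_toEuclideanLin_le_specNorm _ _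
      _ ≤ 1 * ‖toEuclideanLin (D t)ᵀ y‖ := by gcongr
      _ ≤ _ := by
        rw [one_mul]
        exact norm_toEuclideanLin_transpose_le_frobNorm _ _
  have hsq : ‖x‖ * ‖x‖ ≤
      (Real.sqrt K * Real.sqrt (∑ t ∈ s, frobNorm (D t) ^ 2) * ‖y‖) * ‖x‖ := by
    calc ‖x‖ * ‖x‖ = inner ℝ x x := (real_inner_self_eq_norm_mul_norm x).symm
      _ = ∑ t ∈ s, inner ℝ (toEuclideanLin (B t)ᵀ x)
            (toEuclideanLin M (toEuclideanLin (D t)ᵀ y)) := by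
          nth_rewrite 2 [hx]
          rw [map_sum, LinearMap.sum_apply, inner_sum]
          refine Finset.sum_congr rfl fun t _ => ?_
          rw [toEuclideanLin_mul_apply, toEuclideanLin_mul_apply, inner_toEuclideanLin_right]
      _ ≤ ∑ t ∈ s, ‖toEuclideanLin (B t)ᵀ x‖ * (frobNorm (D t) * ‖y‖) := by
          refine Finset.sum_le_sum fun t _ => (real_inner_le_norm _ _).trans ?_
          gcongr
          exact hterm t
      _ = (∑ t ∈ s, ‖toEuclideanLin (B t)ᵀ x‖ * frobNorm (D t)) * ‖y‖ := by
          simp only [Finset.sum_mul, mul_assoc]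
      _ ≤ (Real.sqrt (∑ t ∈ s, ‖toEuclideanLin (B t)ᵀ x‖ ^ 2) *
            Real.sqrt (∑ t ∈ s, frobNorm (D t) ^ 2)) * ‖y‖ := by
          gcongr
          exact Real.sum_mul_le_sqrt_mul_sqrt _ _ _
      _ ≤ (Real.sqrt (K * ‖x‖ ^ 2) * Real.sqrt (∑ t ∈ s, frobNorm (D t) ^ 2)) * ‖y‖ := by
          gcongr
          exact hK x
      _ = _ := by
          rw [Real.sqrt_mul' _ (sq_nonneg _), Real.sqrt_sq (norm_nonneg _)]
          ring
  rcases (norm_nonneg x).eq_or_lt with h0 | h0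
  · rw [← h0]
    positivity
  · exact le_of_mul_le_mul_right hsq h0

/-- **Lipschitz bound in the noise matrices (Step 1 of the iTIPUP proof).** For matrices
`B₁,…,B_T ∈ ℝ^{d₁×d₂}`, `M ∈ ℝ^{d₂×d₂}` with `‖M‖_S ≤ 1`, a lag `1 ≤ h < T`, and noise
matrices `E_t, E'_t ∈ ℝ^{d₁×d₂}` (`t = h+1,…,T`),
`| ‖Σ_{t=h+1}^T B_{t−h} M E_tᵀ‖_S − ‖Σ_{t=h+1}^T B_{t−h} M E'_tᵀ‖_S |
  ≤ ‖Σ_{t=1}^T B_t B_tᵀ‖_S^{1/2} · (Σ_{t=h+1}^T ‖E_t − E'_t‖_F²)^{1/2}`. -/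
theorem lagged_noise_lipschitz (d₁ d₂ T h : ℕ) (hh : 1 ≤ h) (hT : h < T)
    (B : ℕ → Matrix (Fin d₁) (Fin d₂) ℝ) (M : Matrix (Fin d₂) (Fin d₂) ℝ)
    (hM : specNorm M ≤ 1)
    (E E' : ℕ → Matrix (Fin d₁) (Fin d₂) ℝ) :
    |specNorm (∑ t ∈ Icc (h + 1) T, B (t - h) * M * (E t)ᵀ) -
        specNorm (∑ t ∈ Icc (h + 1) T, B (t - h) * M * (E' t)ᵀ)| ≤
      Real.sqrt (specNorm (∑ t ∈ Icc 1 T, B t * (B t)ᵀ)) *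
        Real.sqrt (∑ t ∈ Icc (h + 1) T, (frobNorm (E t - E' t)) ^ 2) := by
  refine (abs_specNorm_sub_specNorm_le _ _).trans ?_
  rw [← Finset.sum_sub_distrib]
  simp only [← Matrix.mul_sub, ← Matrix.transpose_sub]
  refine specNorm_sum_mul_mul_transpose_le _ (fun t => B (t - h)) M hM _ fun x => ?_
  refine le_trans ?_ (sum_norm_sq_toEuclideanLin_transpose_le (Icc 1 T) B x)
  have hinj : Set.InjOn (fun t => t - h) (Icc (h + 1) T : Finset ℕ) := by
    intro a ha b hb hab
    simp only [coe_Icc, Set.mem_Icc] at ha hb hab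
    omega
  rw [← Finset.sum_image (f := fun u => ‖toEuclideanLin (B u)ᵀ x‖ ^ 2) hinj]
  refine Finset.sum_le_sum_of_subset_of_nonneg ?_ fun _ _ _ => sq_nonneg _
  intro u hu
  obtain ⟨t, ht, rfl⟩ := Finset.mem_image.mp hu
  rw [Finset.mem_Icc] at ht ⊢
  omega
end

section
/- Let B₁, …, B_T be real d₁ × d₂ matrices, let h₀ be an integer with 1 ≤ h₀ < T, and let P, Q be real d₂ × d₂ matrices. For 1 ≤ h ≤ h₀ define Θ*_h(P) = (T − h)⁻¹ Σ_{t=h+1}^T B_{t−h} P B_tᵀ and similarly Θ*_h(Q), and define Θ*₀ = T⁻¹ Σ_{t=1}^T B_t B_tᵀ. Then the d₁ × (d₁ h₀) horizontally concatenated matrix [Θ*₁(P) − Θ*₁(Q), …, Θ*_{h₀}(P) − Θ*_{h₀}(Q)] satisfies ‖[Θ*₁(P) − Θ*₁(Q), …, Θ*_{h₀}(P) − Θ*_{h₀}(Q)]‖_S ≤ √h₀ · ‖P − Q‖_S · ‖Θ*₀‖_S / (1 − h₀/T). -/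
open Matrix Finset

/-- The normalized lag-`h` weighted Gram matrix
`Θ*_h(P) = (T − h)⁻¹ Σ_{t=h+1}^T B_{t−h} P B_tᵀ`. -/
noncomputable def laggedGramWith (d₁ d₂ : ℕ) (B : ℕ → Matrix (Fin d₁) (Fin d₂) ℝ)
    (P : Matrix (Fin d₂) (Fin d₂) ℝ) (T h : ℕ) : Matrix (Fin d₁) (Fin d₁) ℝ :=
  ((T : ℝ) - h)⁻¹ • ∑ t ∈ Icc (h + 1) T, B (t - h) * P * (B t)ᵀ

/-- The normalized Gram matrix `Θ*₀ = T⁻¹ Σ_{t=1}^T B_t B_tᵀ`. -/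
noncomputable def gramZero (d₁ d₂ : ℕ) (B : ℕ → Matrix (Fin d₁) (Fin d₂) ℝ) (T : ℕ) :
    Matrix (Fin d₁) (Fin d₁) ℝ :=
  (T : ℝ)⁻¹ • ∑ t ∈ Icc 1 T, B t * (B t)ᵀ

section SpecNorm

variable {m n ι : Type*} [Fintype m] [Fintype n] [Fintype ι]

theorem dotProduct_le_norm_toLp_mul (u v : n → ℝ) :
    u ⬝ᵥ v ≤ ‖WithLp.toLp 2 u‖ * ‖WithLp.toLp 2 v‖ := by
  have h := real_inner_le_norm (WithLp.toLp 2 v) (WithLp.toLp 2 u)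
  rw [EuclideanSpace.inner_toLp_toLp, mul_comm] at h
  simpa using h

theorem dotProduct_self_eq_norm_toLp_sq (u : n → ℝ) :
    u ⬝ᵥ u = ‖WithLp.toLp 2 u‖ ^ 2 := by
  rw [EuclideanSpace.real_norm_sq_eq]
  simp [dotProduct, sq]

variable [DecidableEq n]

theorem specNorm_nonneg (A : Matrix m n ℝ) : 0 ≤ specNorm A :=
  norm_nonneg _

theorem norm_toLp_mulVec_le_specNorm (A : Matrix m n ℝ) (v : n → ℝ) :
    ‖WithLp.toLp 2 (A *ᵥ v)‖ ≤ specNorm A * ‖WithLp.toLp 2 v‖ :=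
  (LinearMap.toContinuousLinearMap (Matrix.toEuclideanLin A)).le_opNorm (WithLp.toLp 2 v)

theorem dotProduct_mulVec_le_specNorm (A : Matrix m n ℝ) (u : m → ℝ) (v : n → ℝ) :
    u ⬝ᵥ A *ᵥ v ≤ specNorm A * (‖WithLp.toLp 2 u‖ * ‖WithLp.toLp 2 v‖) :=
  calc u ⬝ᵥ A *ᵥ v ≤ ‖WithLp.toLp 2 u‖ * ‖WithLp.toLp 2 (A *ᵥ v)‖ :=
        dotProduct_le_norm_toLp_mul _ _
    _ ≤ ‖WithLp.toLp 2 u‖ * (specNorm A * ‖WithLp.toLp 2 v‖) := by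
        gcongr; exact norm_toLp_mulVec_le_specNorm A v
    _ = _ := by ring

theorem specNorm_le_of_norm_mulVec_le (A : Matrix m n ℝ) {c : ℝ} (hc : 0 ≤ c)
    (h : ∀ v : n → ℝ, ‖WithLp.toLp 2 (A *ᵥ v)‖ ≤ c * ‖WithLp.toLp 2 v‖) : specNorm A ≤ c :=
  ContinuousLinearMap.opNorm_le_bound _ hc fun x => h (WithLp.ofLp x)

theorem specNorm_le_of_dotProduct_mulVec_le (A : Matrix m n ℝ) {c : ℝ} (hc : 0 ≤ c)
    (h : ∀ (u : m → ℝ) (v : n → ℝ),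
      u ⬝ᵥ A *ᵥ v ≤ c * (‖WithLp.toLp 2 u‖ * ‖WithLp.toLp 2 v‖)) : specNorm A ≤ c := by
  refine specNorm_le_of_norm_mulVec_le A hc fun v => ?_
  have h1 := h (A *ᵥ v) v
  rw [dotProduct_self_eq_norm_toLp_sq] at h1
  rcases (norm_nonneg (WithLp.toLp 2 (A *ᵥ v))).eq_or_lt with h0 | h0
  · rw [← h0]; positivity
  · exact le_of_mul_le_mul_left (by linarith) h0

/-- A row of blocks, each of spectral norm at most `c`, has spectral norm at most
`√(number of blocks) * c`. -/
theorem specNorm_concat_le [DecidableEq ι] (D : ι → Matrix m n ℝ) {c : ℝ} (hc : 0 ≤ c)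
    (h : ∀ k, specNorm (D k) ≤ c) :
    specNorm (Matrix.of fun (i : m) (p : ι × n) => D p.1 i p.2) ≤
      Real.sqrt (Fintype.card ι) * c := by
  refine specNorm_le_of_norm_mulVec_le _ (by positivity) fun w => ?_
  have hw : (Matrix.of fun (i : m) (p : ι × n) => D p.1 i p.2) *ᵥ w =
      ∑ k, D k *ᵥ fun j => w (k, j) := by
    ext i
    simp [mulVec, dotProduct, Fintype.sum_prod_type]
  have hnorm : ∑ k, ‖WithLp.toLp 2 fun j => w (k, j)‖ ^ 2 = ‖WithLp.toLp 2 w‖ ^ 2 := by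
    simp [EuclideanSpace.real_norm_sq_eq, Fintype.sum_prod_type]
  have hsum : ∑ k, ‖WithLp.toLp 2 fun j => w (k, j)‖ ≤
      Real.sqrt (Fintype.card ι) * ‖WithLp.toLp 2 w‖ := by
    have hcs := Real.sum_mul_le_sqrt_mul_sqrt univ (fun _ : ι => (1 : ℝ))
      fun k => ‖WithLp.toLp 2 fun j => w (k, j)‖
    rw [hnorm, Real.sqrt_sq (norm_nonneg _)] at hcs
    simpa using hcs
  rw [hw, WithLp.toLp_sum]
  calc ‖∑ k, WithLp.toLp 2 (D k *ᵥ fun j => w (k, j))‖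
      ≤ ∑ k, ‖WithLp.toLp 2 (D k *ᵥ fun j => w (k, j))‖ := norm_sum_le _ _
    _ ≤ ∑ k, c * ‖WithLp.toLp 2 fun j => w (k, j)‖ :=
        sum_le_sum fun k _ => (norm_toLp_mulVec_le_specNorm _ _).trans
          (mul_le_mul_of_nonneg_right (h k) (norm_nonneg _))
    _ = c * ∑ k, ‖WithLp.toLp 2 fun j => w (k, j)‖ := (mul_sum _ _ _).symm
    _ ≤ c * (Real.sqrt (Fintype.card ι) * ‖WithLp.toLp 2 w‖) := by gcongr
    _ = _ := by ring

end SpecNorm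

theorem sum_norm_transpose_mulVec_sq_le (d₁ d₂ T : ℕ) (hT : 0 < T)
    (B : ℕ → Matrix (Fin d₁) (Fin d₂) ℝ) (u : Fin d₁ → ℝ) :
    ∑ t ∈ Icc 1 T, ‖WithLp.toLp 2 ((B t)ᵀ *ᵥ u)‖ ^ 2 ≤
      T * specNorm (gramZero d₁ d₂ B T) * ‖WithLp.toLp 2 u‖ ^ 2 := by
  have hu : u ⬝ᵥ gramZero d₁ d₂ B T *ᵥ u =
      (T : ℝ)⁻¹ * ∑ t ∈ Icc 1 T, ‖WithLp.toLp 2 ((B t)ᵀ *ᵥ u)‖ ^ 2 := by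
    simp_rw [gramZero, smul_mulVec, dotProduct_smul, sum_mulVec, dotProduct_sum,
      ← dotProduct_self_eq_norm_toLp_sq, smul_eq_mul, ← mulVec_mulVec, dotProduct_mulVec,
      ← mulVec_transpose]
  have h := dotProduct_mulVec_le_specNorm (gramZero d₁ d₂ B T) u u
  rw [hu, inv_mul_le_iff₀ (by positivity)] at h
  linarith

theorem laggedGramWith_sub (d₁ d₂ : ℕ) (B : ℕ → Matrix (Fin d₁) (Fin d₂) ℝ)
    (P Q : Matrix (Fin d₂) (Fin d₂) ℝ) (T h : ℕ) :
    laggedGramWith d₁ d₂ B P T h - laggedGramWith d₁ d₂ B Q T h =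
      laggedGramWith d₁ d₂ B (P - Q) T h := by
  simp only [laggedGramWith, ← smul_sub, ← sum_sub_distrib, Matrix.mul_sub, Matrix.sub_mul]

theorem specNorm_laggedGramWith_le (d₁ d₂ : ℕ) (B : ℕ → Matrix (Fin d₁) (Fin d₂) ℝ)
    (R : Matrix (Fin d₂) (Fin d₂) ℝ) {T h : ℕ} (hT : h < T) :
    specNorm (laggedGramWith d₁ d₂ B R T h) ≤
      ((T : ℝ) - h)⁻¹ * (specNorm R * (T * specNorm (gramZero d₁ d₂ B T))) := by
  have hT' : (0 : ℝ) < (T : ℝ) - h := sub_pos.2 (by exact_mod_cast hT)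
  have hR := specNorm_nonneg R
  have hG := specNorm_nonneg (gramZero d₁ d₂ B T)
  refine specNorm_le_of_dotProduct_mulVec_le _ (by positivity) fun u v => ?_
  have huv : u ⬝ᵥ laggedGramWith d₁ d₂ B R T h *ᵥ v = ((T : ℝ) - h)⁻¹ *
      ∑ t ∈ Icc (h + 1) T, ((B (t - h))ᵀ *ᵥ u) ⬝ᵥ R *ᵥ ((B t)ᵀ *ᵥ v) := by
    simp_rw [laggedGramWith, smul_mulVec, dotProduct_smul, sum_mulVec, dotProduct_sum,
      smul_eq_mul, ← mulVec_mulVec, dotProduct_mulVec u, ← mulVec_transpose]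
  have hu : ∑ t ∈ Icc (h + 1) T, ‖WithLp.toLp 2 ((B (t - h))ᵀ *ᵥ u)‖ ^ 2 ≤
      T * specNorm (gramZero d₁ d₂ B T) * ‖WithLp.toLp 2 u‖ ^ 2 := by
    refine le_trans ?_ (sum_norm_transpose_mulVec_sq_le d₁ d₂ T (by omega) B u)
    rw [← sum_image (s := Icc (h + 1) T) (g := fun t => t - h)
      (f := fun t => ‖WithLp.toLp 2 ((B t)ᵀ *ᵥ u)‖ ^ 2)]
    · refine sum_le_sum_of_subset_of_nonneg ?_ fun _ _ _ => sq_nonneg _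
      intro s hs
      simp only [mem_image, mem_Icc] at hs ⊢
      omega
    · intro a ha b hb hab
      simp only [coe_Icc, Set.mem_Icc] at ha hb hab
      omega
  have hv : ∑ t ∈ Icc (h + 1) T, ‖WithLp.toLp 2 ((B t)ᵀ *ᵥ v)‖ ^ 2 ≤
      T * specNorm (gramZero d₁ d₂ B T) * ‖WithLp.toLp 2 v‖ ^ 2 :=
    (sum_le_sum_of_subset_of_nonneg (Icc_subset_Icc (by omega) le_rfl)
      fun _ _ _ => sq_nonneg _).trans
      (sum_norm_transpose_mulVec_sq_le d₁ d₂ T (by omega) B v)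
  rw [huv, mul_assoc]
  refine mul_le_mul_of_nonneg_left ?_ (inv_nonneg.2 hT'.le)
  calc ∑ t ∈ Icc (h + 1) T, ((B (t - h))ᵀ *ᵥ u) ⬝ᵥ R *ᵥ ((B t)ᵀ *ᵥ v)
      ≤ ∑ t ∈ Icc (h + 1) T, specNorm R * (‖WithLp.toLp 2 ((B (t - h))ᵀ *ᵥ u)‖ *
          ‖WithLp.toLp 2 ((B t)ᵀ *ᵥ v)‖) :=
        sum_le_sum fun t _ => dotProduct_mulVec_le_specNorm _ _ _
    _ = specNorm R * ∑ t ∈ Icc (h + 1) T, ‖WithLp.toLp 2 ((B (t - h))ᵀ *ᵥ u)‖ *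
          ‖WithLp.toLp 2 ((B t)ᵀ *ᵥ v)‖ := (mul_sum _ _ _).symm
    _ ≤ specNorm R * (√(∑ t ∈ Icc (h + 1) T, ‖WithLp.toLp 2 ((B (t - h))ᵀ *ᵥ u)‖ ^ 2) *
          √(∑ t ∈ Icc (h + 1) T, ‖WithLp.toLp 2 ((B t)ᵀ *ᵥ v)‖ ^ 2)) := by
        gcongr
        exact Real.sum_mul_le_sqrt_mul_sqrt _ _ _
    _ ≤ specNorm R * (√(T * specNorm (gramZero d₁ d₂ B T) * ‖WithLp.toLp 2 u‖ ^ 2) *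
          √(T * specNorm (gramZero d₁ d₂ B T) * ‖WithLp.toLp 2 v‖ ^ 2)) := by
        gcongr
    _ = specNorm R * (T * specNorm (gramZero d₁ d₂ B T)) *
          (‖WithLp.toLp 2 u‖ * ‖WithLp.toLp 2 v‖) := by
        have hTG : 0 ≤ T * specNorm (gramZero d₁ d₂ B T) := by positivity
        rw [Real.sqrt_mul hTG, Real.sqrt_mul hTG, Real.sqrt_sq (norm_nonneg _),
          Real.sqrt_sq (norm_nonneg _), mul_mul_mul_comm, Real.mul_self_sqrt hTG]
        ring

/-- **Perturbation bound for the noiseless TIPUP matrix (Step 4 of the iTIPUP proof).**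
For matrices `B₁,…,B_T ∈ ℝ^{d₁×d₂}`, `P, Q ∈ ℝ^{d₂×d₂}` and `1 ≤ h₀ < T`, the concatenated
matrix `[Θ*₁(P) − Θ*₁(Q), …, Θ*_{h₀}(P) − Θ*_{h₀}(Q)]` satisfies
`‖[Θ*₁(P) − Θ*₁(Q), …, Θ*_{h₀}(P) − Θ*_{h₀}(Q)]‖_S ≤ √h₀ ‖P − Q‖_S ‖Θ*₀‖_S / (1 − h₀/T)`. -/
theorem tipup_perturbation_bound (d₁ d₂ T h₀ : ℕ) (hh : 1 ≤ h₀) (hT : h₀ < T)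
    (B : ℕ → Matrix (Fin d₁) (Fin d₂) ℝ) (P Q : Matrix (Fin d₂) (Fin d₂) ℝ) :
    specNorm (Matrix.of fun (i : Fin d₁) (p : Fin h₀ × Fin d₁) =>
        (laggedGramWith d₁ d₂ B P T ((p.1 : ℕ) + 1) -
          laggedGramWith d₁ d₂ B Q T ((p.1 : ℕ) + 1)) i p.2) ≤
      Real.sqrt (h₀ : ℝ) * specNorm (P - Q) * specNorm (gramZero d₁ d₂ B T) /
        (1 - (h₀ : ℝ) / T) := by
  have hT0 : (0 : ℝ) < T := by exact_mod_cast (by omega : 0 < T)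
  have hpos : (0 : ℝ) < (T : ℝ) - h₀ := sub_pos.2 (by exact_mod_cast hT)
  have hR := specNorm_nonneg (P - Q)
  have hG := specNorm_nonneg (gramZero d₁ d₂ B T)
  have hblock : ∀ k : Fin h₀, specNorm (laggedGramWith d₁ d₂ B P T ((k : ℕ) + 1) -
      laggedGramWith d₁ d₂ B Q T ((k : ℕ) + 1)) ≤
      ((T : ℝ) - h₀)⁻¹ * (specNorm (P - Q) * (T * specNorm (gramZero d₁ d₂ B T))) := by
    intro k
    have hk : (((k : ℕ) + 1 : ℕ) : ℝ) ≤ h₀ := by exact_mod_cast k.isLt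
    rw [laggedGramWith_sub]
    refine (specNorm_laggedGramWith_le d₁ d₂ B (P - Q) (by omega)).trans ?_
    gcongr
  have hmain := specNorm_concat_le _ (by positivity) hblock
  rw [Fintype.card_fin] at hmain
  refine hmain.trans_eq ?_
  have hne : (1 : ℝ) - h₀ / T = (T - h₀) / T := by field_simp
  rw [hne]
  field_simp
end
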